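/- As n → ∞, s_n = (1 + o(1)) · log₂(n)/(2n); that is, the ratio 2n·s_n / log₂(n) tends to 1 as n → ∞. -/

import Mathlib

/-- A finite family of finite sets is union-closed if it is closed under pairwise unions. -/
def UnionClosed (F : Finset (Finset ℕ)) : Prop :=
  ∀ A ∈ F, ∀ B ∈ F, A ∪ B ∈ F

/-- The density of a union-closed family `F`:
`D(F) = (1/(n·|F|)) · Σ_{A ∈ F} |A|` where `n = |⋃F|`. -/
noncomputable def density (F : Finset (Finset ℕ)) : ℝ :=
  (∑ A ∈ F, (A.card : ℝ)) / (((F.sup id).card : ℝ) * (F.card : ℝ))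

/-- `minDensity n` is the minimum density over all union-closed families whose
union has exactly `n` elements. -/
noncomputable def minDensity (n : ℕ) : ℝ :=
  sInf {d : ℝ | ∃ F : Finset (Finset ℕ),
    UnionClosed F ∧ (F.sup id).card = n ∧ d = density F}

open Finset

def phi : ℕ → Finset (Finset ℕ) → Finset ℕ → Finset ℕ
  | 0, _, A => A
  | n+1, F, A =>
    if n ∈ A then insert n (phi n (F.memberSubfamily n) (A.erase n))
    else if phi n (F.nonMemberSubfamily n) A ∈
        (F.memberSubfamily n).image (phi n (F.memberSubfamily n))
      then phi n (F.nonMemberSubfamily n) A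
      else insert n (phi n (F.nonMemberSubfamily n) A)

def UU (n : ℕ) (F : Finset (Finset ℕ)) : Finset (Finset ℕ) := F.image (phi n F)

lemma mem_UU {n F V} : V ∈ UU n F ↔ ∃ A ∈ F, phi n F A = V := by
  simp [UU]

def In (n : ℕ) (F : Finset (Finset ℕ)) : Prop := ∀ A ∈ F, ∀ i ∈ A, i < n

lemma In.mem {n F} (h : In (n+1) F) : In n (F.memberSubfamily n) := by
  intro A hA i hi
  rw [mem_memberSubfamily] at hA
  have := h _ hA.1 i (by simp [hi])
  have : i ≠ n := by rintro rfl; exact hA.2 hi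
  omega

lemma In.nonmem {n F} (h : In (n+1) F) : In n (F.nonMemberSubfamily n) := by
  intro A hA i hi
  rw [mem_nonMemberSubfamily] at hA
  have := h _ hA.1 i hi
  have : i ≠ n := by rintro rfl; exact hA.2 hi
  omega

lemma erase_mem_ms {n : ℕ} {F : Finset (Finset ℕ)} {A} (hA : A ∈ F) (h : n ∈ A) :
    A.erase n ∈ F.memberSubfamily n := by
  rw [mem_memberSubfamily]; simp [insert_erase h, hA]

lemma phi_mem {n F A} (h : n ∈ A) :
    phi (n+1) F A = insert n (phi n (F.memberSubfamily n) (A.erase n)) := by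
  simp [phi, h]

lemma phi_nonmem {n F A} (h : n ∉ A) :
    phi (n+1) F A = if phi n (F.nonMemberSubfamily n) A ∈ UU n (F.memberSubfamily n)
      then phi n (F.nonMemberSubfamily n) A
      else insert n (phi n (F.nonMemberSubfamily n) A) := by
  rw [phi, if_neg h]; rfl

lemma phi_lt {n F} (hF : In n F) {A} (hA : A ∈ F) : ∀ i ∈ phi n F A, i < n := by
  induction n generalizing F A with
  | zero => exact hF A hA
  | succ n ih =>
    intro i hi
    by_cases h : n ∈ A
    · rw [phi_mem h, mem_insert] at hi
      rcases hi with rfl | hi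
      · omega
      · have := ih hF.mem (erase_mem_ms hA h) i hi; omega
    · have h1 := ih hF.nonmem (mem_nonMemberSubfamily.2 ⟨hA, h⟩) i
      rw [phi_nonmem h] at hi
      split_ifs at hi
      · have := h1 hi; omega
      · rw [mem_insert] at hi
        rcases hi with rfl | hi
        · omega
        · have := h1 hi; omega

lemma subset_phi {n F} (hF : In n F) {A} (hA : A ∈ F) : A ⊆ phi n F A := by
  induction n generalizing F A with
  | zero => simp [phi]
  | succ n ih =>
    by_cases h : n ∈ A
    · rw [phi_mem h]
      have := ih hF.mem (erase_mem_ms hA h)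
      rw [← insert_erase h]
      conv_rhs => rw [insert_erase h]
      exact insert_subset_insert _ this
    · have h1 := ih hF.nonmem (mem_nonMemberSubfamily.2 ⟨hA, h⟩)
      rw [phi_nonmem h]
      split_ifs
      · exact h1
      · exact h1.trans (subset_insert _ _)

lemma UU_lt {n F} (hF : In n F) {V} (hV : V ∈ UU n F) : ∀ i ∈ V, i < n := by
  obtain ⟨A, hA, rfl⟩ := mem_UU.1 hV
  exact phi_lt hF hA

lemma UU_notMem {n F} (hF : In n F) {V} (hV : V ∈ UU n F) : n ∉ V := fun h =>
  absurd (UU_lt hF hV n h) (by omega)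

lemma UU_succ_insert {n F} (hF : In (n+1) F) {V} (hn : n ∉ V) :
    insert n V ∈ UU (n+1) F ↔
      V ∈ UU n (F.memberSubfamily n) ∨ V ∈ UU n (F.nonMemberSubfamily n) := by
  constructor
  · intro h
    obtain ⟨A, hA, e⟩ := mem_UU.1 h
    by_cases h : n ∈ A
    · rw [phi_mem h] at e
      have h2 := erase_mem_ms hA h
      have h3 : phi n (F.memberSubfamily n) (A.erase n) ∈ UU n (F.memberSubfamily n) :=
        mem_UU.2 ⟨_, h2, rfl⟩
      have h4 := UU_notMem hF.mem h3
      left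
      have := congrArg (fun s => s.erase n) e
      simp only [erase_insert hn, erase_insert h4] at this
      rwa [← this]
    · have h2 : A ∈ F.nonMemberSubfamily n := mem_nonMemberSubfamily.2 ⟨hA, h⟩
      have h3 : phi n (F.nonMemberSubfamily n) A ∈ UU n (F.nonMemberSubfamily n) :=
        mem_UU.2 ⟨_, h2, rfl⟩
      have h4 := UU_notMem hF.nonmem h3
      rw [phi_nonmem h] at e
      split_ifs at e with h5
      · exact absurd (e ▸ mem_insert_self n V) h4
      · right
        have := congrArg (fun s => s.erase n) e
        simp only [erase_insert hn, erase_insert h4] at this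
        rwa [← this]
  · intro h
    have key : V ∈ UU n (F.memberSubfamily n) → insert n V ∈ UU (n+1) F := by
      intro h
      obtain ⟨A, hA, e⟩ := mem_UU.1 h
      rw [mem_memberSubfamily] at hA
      refine mem_UU.2 ⟨insert n A, hA.1, ?_⟩
      rw [phi_mem (by simp), erase_insert hA.2, e]
    rcases h with h | h
    · exact key h
    · by_cases h' : V ∈ UU n (F.memberSubfamily n)
      · exact key h'
      · obtain ⟨A, hA, e⟩ := mem_UU.1 h
        rw [mem_nonMemberSubfamily] at hA
        refine mem_UU.2 ⟨A, hA.1, ?_⟩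
        rw [phi_nonmem hA.2, e, if_neg h']

lemma UU_succ_not {n F} (_hF : In (n+1) F) {V} (hn : n ∉ V) :
    V ∈ UU (n+1) F ↔
      V ∈ UU n (F.memberSubfamily n) ∧ V ∈ UU n (F.nonMemberSubfamily n) := by
  constructor
  · intro h
    obtain ⟨A, hA, e⟩ := mem_UU.1 h
    by_cases h : n ∈ A
    · rw [phi_mem h] at e
      exact absurd (e ▸ mem_insert_self _ _) hn
    · have h2 : A ∈ F.nonMemberSubfamily n := mem_nonMemberSubfamily.2 ⟨hA, h⟩
      rw [phi_nonmem h] at e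
      split_ifs at e with h5
      · exact ⟨e ▸ h5, mem_UU.2 ⟨_, h2, e⟩⟩
      · exact absurd (e ▸ mem_insert_self _ _) hn
  · rintro ⟨h', h⟩
    obtain ⟨A, hA, e⟩ := mem_UU.1 h
    rw [mem_nonMemberSubfamily] at hA
    refine mem_UU.2 ⟨A, hA.1, ?_⟩
    rw [phi_nonmem hA.2, e, if_pos h']

def Upp (n : ℕ) (U : Finset (Finset ℕ)) : Prop :=
  ∀ V ∈ U, ∀ W : Finset ℕ, V ⊆ W → (∀ i ∈ W, i < n) → W ∈ U

lemma UU_upper {n F} (hF : In n F) : Upp n (UU n F) := by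
  induction n generalizing F with
  | zero =>
    intro V hV W hVW hW
    have h1 := UU_lt hF hV
    have : V = W := by
      ext i; exact ⟨fun h => hVW h, fun h => absurd (hW i h) (by omega)⟩
    exact this ▸ hV
  | succ n ih =>
    intro V hV W hVW hW
    have i1 := ih hF.mem
    have i0 := ih hF.nonmem
    have hW' : ∀ i ∈ W.erase n, i < n := by
      intro i hi
      rw [mem_erase] at hi
      have := hW i hi.2
      omega
    by_cases hn : n ∈ V
    · have hnW := hVW hn
      rw [← insert_erase hn, UU_succ_insert hF (by simp)] at hV
      rw [← insert_erase hnW, UU_succ_insert hF (by simp)]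
      have := erase_subset_erase n hVW
      exact hV.imp (fun h => i1 _ h _ this hW') (fun h => i0 _ h _ this hW')
    · rw [UU_succ_not hF hn] at hV
      have hs : V ⊆ W.erase n := by
        intro i hi
        rw [mem_erase]
        exact ⟨by rintro rfl; exact hn hi, hVW hi⟩
      have := i1 _ hV.1 _ hs hW'
      by_cases hnW : n ∈ W
      · rw [← insert_erase hnW, UU_succ_insert hF (by simp)]
        exact Or.inl this
      · rw [UU_succ_not hF hnW]
        rw [erase_eq_of_notMem hnW] at this hs hW'
        exact ⟨this, i0 _ hV.2 _ hs hW'⟩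

def Abs (F G : Finset (Finset ℕ)) : Prop := ∀ A ∈ F, ∀ B ∈ G, A ∪ B ∈ G

lemma Abs.m0m1 {n : ℕ} {F G : Finset (Finset ℕ)} (h : Abs F G) :
    Abs (F.nonMemberSubfamily n) (G.memberSubfamily n) := by
  intro A hA B hB
  rw [mem_nonMemberSubfamily] at hA
  rw [mem_memberSubfamily] at hB ⊢
  refine ⟨?_, by simp [hA.2, hB.2]⟩
  have := h A hA.1 _ hB.1
  rwa [union_insert] at this
lemma Abs.m0m0 {n : ℕ} {F G : Finset (Finset ℕ)} (h : Abs F G) :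
    Abs (F.nonMemberSubfamily n) (G.nonMemberSubfamily n) := by
  intro A hA B hB
  rw [mem_nonMemberSubfamily] at hA hB ⊢
  exact ⟨h A hA.1 _ hB.1, by simp [hA.2, hB.2]⟩
lemma Abs.m1m1 {n : ℕ} {F G : Finset (Finset ℕ)} (h : Abs F G) :
    Abs (F.memberSubfamily n) (G.memberSubfamily n) := by
  intro A hA B hB
  rw [mem_memberSubfamily] at hA hB ⊢
  refine ⟨?_, by simp [hA.2, hB.2]⟩
  have := h _ hA.1 _ hB.1
  rwa [← insert_union_distrib] at this
lemma Abs.m1m0 {n : ℕ} {F G : Finset (Finset ℕ)} (h : Abs F G) {A B}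
    (hA : A ∈ F.memberSubfamily n) (hB : B ∈ G.nonMemberSubfamily n) :
    A ∪ B ∈ G.memberSubfamily n := by
  rw [mem_nonMemberSubfamily] at hB
  rw [mem_memberSubfamily] at hA ⊢
  refine ⟨?_, by simp [hA.2, hB.2]⟩
  have := h _ hA.1 _ hB.1
  rwa [insert_union] at this

lemma key {n F G} (hF : In n F) (hG : In n G) (h : Abs F G) {A B}
    (hA : A ∈ F) (hB : B ∈ G) (hAB : A ⊆ B) (hBA : B ⊆ phi n F A) :
    phi n F A ∈ UU n G := by
  induction n generalizing F G A B with
  | zero =>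
    simp only [phi] at *
    have : A = B := hAB.antisymm hBA
    exact mem_UU.2 ⟨B, hB, by simp [phi, this]⟩
  | succ n ih =>
    by_cases hnA : n ∈ A
    · have hnB := hAB hnA
      have hA' := erase_mem_ms hA hnA
      have h4 := UU_notMem hF.mem (mem_UU.2 ⟨_, hA', rfl⟩)
      rw [phi_mem hnA] at hBA ⊢
      rw [UU_succ_insert hG h4]
      left
      refine ih hF.mem hG.mem h.m1m1 hA' (erase_mem_ms hB hnB) (erase_subset_erase n hAB) ?_
      have := erase_subset_erase n hBA
      rwa [erase_insert h4] at this
    · have hA' : A ∈ F.nonMemberSubfamily n := mem_nonMemberSubfamily.2 ⟨hA, hnA⟩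
      have h4 := UU_notMem hF.nonmem (mem_UU.2 ⟨_, hA', rfl⟩)
      rw [phi_nonmem hnA] at hBA ⊢
      by_cases hnB : n ∈ B
      · split_ifs at hBA ⊢ with h5
        · exact absurd (hBA hnB) h4
        · rw [UU_succ_insert hG h4]
          left
          refine ih hF.nonmem hG.mem h.m0m1 hA' (erase_mem_ms hB hnB) ?_ ?_
          · intro i hi
            rw [mem_erase]
            exact ⟨by rintro rfl; exact hnA hi, hAB hi⟩
          · have := erase_subset_erase n hBA
            rwa [erase_insert h4] at this
      · have hB' : B ∈ G.nonMemberSubfamily n := mem_nonMemberSubfamily.2 ⟨hB, hnB⟩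
        have hBA' : B ⊆ phi n (F.nonMemberSubfamily n) A := by
          split_ifs at hBA
          · exact hBA
          · rwa [subset_insert_iff_of_notMem hnB] at hBA
        have h0 := ih hF.nonmem hG.nonmem h.m0m0 hA' hB' hAB hBA'
        split_ifs with h5
        · rw [UU_succ_not hG h4]
          refine ⟨?_, h0⟩
          obtain ⟨C, hC, e⟩ := mem_UU.1 h5
          rw [← e] at hBA' ⊢
          exact ih hF.mem hG.mem h.m1m1 hC (h.m1m0 hC hB') subset_union_left
            (union_subset (subset_phi hF.mem hC) hBA')
        · rw [UU_succ_insert hG h4]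
          exact Or.inr h0

lemma disj {n F} (hF : In n F) (h : Abs F F) {A B X} (hA : A ∈ F) (hB : B ∈ F)
    (h1 : A ⊆ X) (h2 : X ⊆ phi n F A) (h3 : B ⊆ X) (h4 : X ⊆ phi n F B) : A = B := by
  induction n generalizing F A B X with
  | zero => exact (h1.trans h4).antisymm (h3.trans h2)
  | succ n ih =>
    -- the mixed case
    have mixed : ∀ {A B X : Finset ℕ}, A ∈ F.nonMemberSubfamily n → B ∈ F.memberSubfamily n →
        A ⊆ X → X ⊆ phi n (F.nonMemberSubfamily n) A → B ⊆ X →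
        X ⊆ phi n (F.memberSubfamily n) B →
        phi n (F.nonMemberSubfamily n) A ∈ UU n (F.memberSubfamily n) := by
      intro A B X hA hB h1 h2 h3 h4
      have hAB := h.m0m1 A hA B hB
      have hs := subset_phi hF.mem hAB
      have e : A ∪ B = B := ih hF.mem h.m1m1 hAB hB (Subset.refl _) hs subset_union_right
        (union_subset (h1.trans h4) (h3.trans h4))
      exact key hF.nonmem hF.mem h.m0m1 hA hB (union_eq_right.1 e) (h3.trans h2)
    have mixed2 : ∀ {A B X : Finset ℕ}, A ∈ F → B ∈ F → n ∉ A → n ∈ B →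
        A ⊆ X → X ⊆ phi (n+1) F A → B ⊆ X → X ⊆ phi (n+1) F B → False := by
      intro A B X hA hB hnA hnB h1 h2 h3 h4
      have hA' : A ∈ F.nonMemberSubfamily n := mem_nonMemberSubfamily.2 ⟨hA, hnA⟩
      have hB' := erase_mem_ms hB hnB
      have hA4 := UU_notMem hF.nonmem (mem_UU.2 ⟨_, hA', rfl⟩)
      have hB4 := UU_notMem hF.mem (mem_UU.2 ⟨_, hB', rfl⟩)
      rw [phi_nonmem hnA] at h2
      rw [phi_mem hnB] at h4
      split_ifs at h2 with h5
      · exact hA4 (h2 (h3 hnB))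
      · apply h5
        refine mixed (X := X.erase n) hA' hB' ?_ ?_ (erase_subset_erase n h3) ?_
        · intro i hi
          rw [mem_erase]
          exact ⟨by rintro rfl; exact hnA hi, h1 hi⟩
        · have := erase_subset_erase n h2
          rwa [erase_insert hA4] at this
        · have := erase_subset_erase n h4
          rwa [erase_insert hB4] at this
    by_cases hnA : n ∈ A <;> by_cases hnB : n ∈ B
    · have hA' := erase_mem_ms hA hnA
      have hB' := erase_mem_ms hB hnB
      have hA4 := UU_notMem hF.mem (mem_UU.2 ⟨_, hA', rfl⟩)
      have hB4 := UU_notMem hF.mem (mem_UU.2 ⟨_, hB', rfl⟩)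
      rw [phi_mem hnA] at h2
      rw [phi_mem hnB] at h4
      have e2 := erase_subset_erase n h2
      have e4 := erase_subset_erase n h4
      rw [erase_insert hA4] at e2
      rw [erase_insert hB4] at e4
      have := ih hF.mem h.m1m1 hA' hB' (erase_subset_erase n h1) e2 (erase_subset_erase n h3) e4
      rw [← insert_erase hnA, this, insert_erase hnB]
    · exact (mixed2 hB hA hnB hnA h3 h4 h1 h2).elim
    · exact (mixed2 hA hB hnA hnB h1 h2 h3 h4).elim
    · have hA' : A ∈ F.nonMemberSubfamily n := mem_nonMemberSubfamily.2 ⟨hA, hnA⟩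
      have hB' : B ∈ F.nonMemberSubfamily n := mem_nonMemberSubfamily.2 ⟨hB, hnB⟩
      have aux : ∀ {A : Finset ℕ}, n ∉ A → X ⊆ phi (n+1) F A →
          X.erase n ⊆ phi n (F.nonMemberSubfamily n) A := by
        intro A hnA h2
        rw [phi_nonmem hnA] at h2
        rw [← subset_insert_iff]
        split_ifs at h2
        · exact h2.trans (subset_insert _ _)
        · exact h2
      have aux2 : ∀ {A : Finset ℕ}, n ∉ A → A ⊆ X → A ⊆ X.erase n := by
        intro A hnA h1 i hi
        rw [mem_erase]
        exact ⟨by rintro rfl; exact hnA hi, h1 hi⟩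
      exact ih hF.nonmem h.m0m0 hA' hB' (aux2 hnA h1) (aux hnA h2) (aux2 hnB h3) (aux hnB h4)

lemma num_ineq {a b : ℝ} (hb : 0 ≤ b) (hab : b ≤ a) :
    a * Real.log a + b * Real.log b + 2 * b * Real.log 2 ≤ (a + b) * Real.log (a + b) := by
  rcases hb.eq_or_lt with rfl | hb
  · simp
  have ha : 0 < a := hb.trans_le hab
  have hs : 0 < a + b := by positivity
  set p := b / (a + b) with hp
  have hp0 : 0 ≤ p := by positivity
  have hp1 : p ≤ 1/2 := by rw [hp, div_le_iff₀ hs]; linarith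
  have hc := Real.strictConcave_binEntropy.concaveOn.2 (show (0:ℝ) ∈ Set.Icc 0 1 by simp)
    (show (2⁻¹:ℝ) ∈ Set.Icc 0 1 by norm_num) (show 0 ≤ 1 - 2 * p by linarith)
    (show 0 ≤ 2 * p by linarith) (by ring)
  simp only [Real.binEntropy_zero, Real.binEntropy_two_inv, smul_eq_mul, mul_zero, zero_add] at hc
  rw [show 2 * p * 2⁻¹ = p by ring, Real.binEntropy_eq_negMulLog_add_negMulLog_one_sub] at hc
  have h1 : 1 - p = a / (a + b) := by rw [hp]; field_simp; ring
  rw [h1, hp, Real.negMulLog, Real.negMulLog, Real.log_div hb.ne' hs.ne',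
    Real.log_div ha.ne' hs.ne'] at hc
  have := mul_le_mul_of_nonneg_left hc hs.le
  field_simp at this
  linarith

lemma sum_split (n : ℕ) (U : Finset (Finset ℕ)) (f : Finset ℕ → ℝ) :
    ∑ V ∈ U, f V = ∑ V ∈ U.memberSubfamily n, f (insert n V)
      + ∑ V ∈ U.nonMemberSubfamily n, f V := by
  rw [← sum_filter_add_sum_filter_not U (fun s => n ∈ s), ← image_insert_memberSubfamily,
    sum_image]
  · rfl
  · intro A hA B hB e
    have hA := (mem_memberSubfamily.1 hA).2
    have hB := (mem_memberSubfamily.1 hB).2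
    have := congrArg (fun s => s.erase n) e
    simpa only [erase_insert hA, erase_insert hB] using this

lemma iso {n U} (hU : In n U) (h : Upp n U) :
    2 * Real.log 2 * ∑ V ∈ U, ((n : ℝ) - #V) ≤ (#U : ℝ) * Real.log #U := by
  induction n generalizing U with
  | zero =>
    have : ∑ V ∈ U, (((0:ℕ) : ℝ) - #V) ≤ 0 := by
      apply sum_nonpos; intro V _; simp
    have h2 : 0 ≤ (#U : ℝ) * Real.log #U := by
      apply mul_nonneg (by positivity); exact Real.log_natCast_nonneg _
    have := mul_nonpos_of_nonneg_of_nonpos (show 0 ≤ 2 * Real.log 2 by positivity) this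
    linarith
  | succ n ih =>
    have u1 : Upp n (U.memberSubfamily n) := by
      intro V hV W hVW hW
      rw [mem_memberSubfamily] at hV ⊢
      refine ⟨h _ hV.1 _ (insert_subset_insert _ hVW) ?_, fun h => absurd (hW _ h) (by omega)⟩
      intro i hi
      rw [mem_insert] at hi
      rcases hi with rfl | hi
      · omega
      · have := hW i hi; omega
    have u0 : Upp n (U.nonMemberSubfamily n) := by
      intro V hV W hVW hW
      rw [mem_nonMemberSubfamily] at hV ⊢
      refine ⟨h _ hV.1 _ hVW ?_, fun h => absurd (hW _ h) (by omega)⟩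
      intro i hi
      have := hW i hi; omega
    have hs : U.nonMemberSubfamily n ⊆ U.memberSubfamily n := by
      intro V hV
      have hl := hU.nonmem _ hV
      rw [mem_nonMemberSubfamily] at hV
      rw [mem_memberSubfamily]
      refine ⟨h _ hV.1 _ (subset_insert _ _) ?_, hV.2⟩
      intro i hi
      rw [mem_insert] at hi
      rcases hi with rfl | hi
      · omega
      · have := hl i hi; omega
    have i1 := ih hU.mem u1
    have i0 := ih hU.nonmem u0
    have hc : (#(U.memberSubfamily n) : ℝ) + #(U.nonMemberSubfamily n) = #U := by
      exact_mod_cast card_memberSubfamily_add_card_nonMemberSubfamily n U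
    have hn := num_ineq (a := (#(U.memberSubfamily n) : ℝ)) (b := #(U.nonMemberSubfamily n))
      (by positivity) (by exact_mod_cast card_le_card hs)
    rw [hc] at hn
    rw [sum_split n]
    have e1 : ∑ V ∈ U.memberSubfamily n, (((n+1 : ℕ) : ℝ) - #(insert n V))
        = ∑ V ∈ U.memberSubfamily n, ((n : ℝ) - #V) := by
      apply sum_congr rfl
      intro V hV
      rw [card_insert_of_notMem (mem_memberSubfamily.1 hV).2]; push_cast; ring
    have e0 : ∑ V ∈ U.nonMemberSubfamily n, (((n+1 : ℕ) : ℝ) - #V)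
        = ∑ V ∈ U.nonMemberSubfamily n, ((n : ℝ) - #V) + #(U.nonMemberSubfamily n) := by
      rw [card_eq_sum_ones, Nat.cast_sum, ← sum_add_distrib]
      apply sum_congr rfl
      intro V hV
      push_cast; ring
    rw [e1, e0]
    linarith

lemma sum_pow_le {n F} (hF : In n F) (h : Abs F F) :
    ∑ A ∈ F, 2 ^ (#(phi n F A) - #A) ≤ 2 ^ n := by
  have e : ∀ A ∈ F, 2 ^ (#(phi n F A) - #A) = #(Icc A (phi n F A)) := fun A hA => by
    rw [card_Icc_finset (subset_phi hF hA)]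
  rw [sum_congr rfl e, ← card_biUnion]
  · calc _ ≤ #((range n).powerset) := by
          apply card_le_card
          intro X hX
          rw [mem_biUnion] at hX
          obtain ⟨A, hA, hX⟩ := hX
          rw [mem_powerset]
          intro i hi
          exact mem_range.2 (phi_lt hF hA i ((mem_Icc.1 hX).2 hi))
      _ = 2 ^ n := by simp
  · intro A hA B hB hne
    rw [Function.onFun, disjoint_left]
    intro X hX hX'
    rw [mem_Icc] at hX hX'
    exact hne (disj hF h hA hB hX.1 hX.2 hX'.1 hX'.2)

lemma jensen {F : Finset (Finset ℕ)} (hne : F.Nonempty) (d : Finset ℕ → ℕ) (n : ℕ)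
    (h : ∑ A ∈ F, 2 ^ (d A) ≤ 2 ^ n) :
    Real.log 2 * ∑ A ∈ F, (d A : ℝ) ≤ #F * (n * Real.log 2 - Real.log #F) := by
  have hm : (0 : ℝ) < #F := by exact_mod_cast hne.card_pos
  set L := n * Real.log 2 - Real.log #F with hL
  have hp : ∀ k : ℕ, (2:ℝ) ^ k = Real.exp (k * Real.log 2) := by
    intro k
    rw [Real.exp_nat_mul, Real.exp_log (by norm_num)]
  have heL : Real.exp L = 2 ^ n / #F := by
    rw [hL, Real.exp_sub, ← hp, Real.exp_log hm]
  have h' : ∑ A ∈ F, (2:ℝ) ^ (d A) ≤ 2 ^ n := by exact_mod_cast h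
  have h2 : ∑ A ∈ F, Real.exp L * (1 + (d A * Real.log 2 - L)) ≤ ∑ A ∈ F, (2:ℝ) ^ (d A) := by
    apply sum_le_sum
    intro A _
    rw [hp, show (d A * Real.log 2) = L + (d A * Real.log 2 - L) by ring, Real.exp_add]
    apply mul_le_mul_of_nonneg_left _ (Real.exp_pos _).le
    have := Real.add_one_le_exp (d A * Real.log 2 - L)
    ring_nf at this ⊢
    linarith
  have h3 := h2.trans h'
  rw [← mul_sum, heL, sum_add_distrib, sum_sub_distrib, ← sum_mul] at h3
  simp only [sum_const, nsmul_eq_mul, mul_one] at h3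
  rw [div_mul_eq_mul_div, div_le_iff₀ hm] at h3
  have := le_of_mul_le_mul_left h3 (by positivity)
  linarith

theorem reimer {F : Finset (Finset ℕ)} (hne : F.Nonempty) (h : Abs F F) :
    #F * Real.log #F ≤ 2 * Real.log 2 * ∑ A ∈ F, (#A : ℝ) := by
  obtain ⟨n, hF⟩ : ∃ n, In n F := by
    refine ⟨(F.sup id).sup id + 1, fun A hA i hi => ?_⟩
    have : i ∈ F.sup id := (le_sup (f := id) hA : A ≤ F.sup id) hi
    have : i ≤ (F.sup id).sup id := le_sup (f := id) this
    omega
  have inj : Set.InjOn (phi n F) F := by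
    intro A hA B hB e
    exact disj hF h hA hB (subset_phi hF hA) (Subset.refl _) (e ▸ subset_phi hF hB)
      (e ▸ Subset.refl _)
  have hc : #(UU n F) = #F := card_image_of_injOn inj
  have h1 := iso (fun V hV => UU_lt hF hV) (UU_upper hF)
  rw [hc, UU, sum_image inj] at h1
  have h2 := jensen hne (fun A => #(phi n F A) - #A) n (sum_pow_le hF h)
  have e : ∑ A ∈ F, ((#(phi n F A) - #A : ℕ) : ℝ) = ∑ A ∈ F, ((#(phi n F A) : ℝ) - #A) := by
    apply sum_congr rfl
    intro A hA
    rw [Nat.cast_sub (card_le_card (subset_phi hF hA))]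
  rw [e, sum_sub_distrib] at h2
  rw [sum_sub_distrib] at h1
  simp only [sum_const, nsmul_eq_mul] at h1
  linarith

lemma frac_aux {n S m : ℝ} (hn : n ≠ 0) (hm : m ≠ 0) : 2 * n * (S / (n * m)) = 2 * S / m := by
  field_simp

lemma sup_mem_uc {F : Finset (Finset ℕ)} (hne : F.Nonempty) (h : Abs F F) : F.sup id ∈ F := by
  rw [← sup'_eq_sup hne]
  exact sup'_mem (F : Set (Finset ℕ)) (fun x hx y hy => h x hx y hy) F hne id (fun i hi => hi)

lemma lower {n : ℕ} {F : Finset (Finset ℕ)} (h : UnionClosed F) (hn : #(F.sup id) = n)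
    (h2 : 2 ≤ n) (hL : 1 ≤ Real.logb 2 n) :
    Real.logb 2 n - Real.logb 2 (Real.logb 2 n) ≤ 2 * (n:ℝ) * density F := by
  have hne : F.Nonempty := by
    rw [nonempty_iff_ne_empty]; rintro rfl; simp at hn; omega
  have hm : (0:ℝ) < #F := by exact_mod_cast hne.card_pos
  have hn0 : (0:ℝ) < n := by exact_mod_cast (by omega : 0 < n)
  have hR := reimer hne h
  have hS : (n:ℝ) ≤ ∑ A ∈ F, (#A:ℝ) := by
    rw [← hn]
    exact single_le_sum (f := fun A : Finset ℕ => (#A:ℝ)) (fun _ _ => by positivity)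
      (sup_mem_uc hne h)
  have hl2 : 0 < Real.log 2 := by positivity
  have hD : 2 * (n:ℝ) * density F = 2 * (∑ A ∈ F, (#A : ℝ)) / #F := by
    rw [density, hn]; field_simp
  rw [hD, le_div_iff₀ hm]
  set S := ∑ A ∈ F, (#A : ℝ)
  set L := Real.logb 2 n with hLdef
  have hll : 0 ≤ Real.logb 2 L := Real.logb_nonneg (by norm_num) hL
  rcases le_total ((#F:ℝ) * L) (2 * n) with hc | hc
  · nlinarith
  · have hF : 2 * n / L ≤ #F := by rw [div_le_iff₀ (by linarith)]; exact hc
    have h3 : Real.logb 2 (2 * n / L) ≤ Real.logb 2 #F :=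
      Real.logb_le_logb_of_le (by norm_num) (by positivity) hF
    rw [Real.logb_div (by positivity) (by positivity), Real.logb_mul (by norm_num) hn0.ne',
      ← hLdef, Real.logb_self_eq_one (by norm_num)] at h3
    have h4 : #F * Real.logb 2 #F ≤ 2 * S := by
      rw [Real.logb, ← mul_div_assoc, div_le_iff₀ hl2]; linarith
    nlinarith

lemma sum_pow_card (k : ℕ) : 2 * ∑ A ∈ (range k).powerset, #A = k * 2 ^ k := by
  rw [sum_powerset_apply_card (fun i => i), card_range]
  simp only [smul_eq_mul]
  have := Nat.sum_range_mul_choose k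
  simp_rw [mul_comm (Nat.choose _ _)]
  rw [this]
  cases k with
  | zero => simp
  | succ k => simp [pow_succ]; ring

lemma density_nonneg (F : Finset (Finset ℕ)) : 0 ≤ density F := by
  unfold density; positivity

lemma upper {n : ℕ} (h2 : 2 ≤ n) : ∃ F, UnionClosed F ∧ #(F.sup id) = n ∧
    2 * (n:ℝ) * density F ≤ Real.logb 2 n + 3 := by
  have hn0 : (0:ℝ) < n := by exact_mod_cast (by omega : 0 < n)
  set k := Nat.clog 2 n with hk
  have hk1 : n ≤ 2 ^ k := Nat.le_pow_clog (by norm_num) n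
  have hk2 : 2 ^ (k - 1) < n := Nat.pow_pred_clog_lt_self (by norm_num) (by omega)
  have hkn : k ≤ n := by
    have := Nat.lt_two_pow_self (n := k - 1); omega
  have hkL : (k:ℝ) ≤ Real.logb 2 n + 1 := by
    have : Real.logb 2 ((2:ℝ) ^ (k-1)) ≤ Real.logb 2 n :=
      Real.logb_le_logb_of_le (by norm_num) (by positivity) (by exact_mod_cast hk2.le)
    rw [Real.logb_pow, Real.logb_self_eq_one (by norm_num)] at this
    have h3 : (k:ℝ) ≤ ((k-1 : ℕ):ℝ) + 1 := by exact_mod_cast (by omega)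
    linarith
  set P := (range k).powerset
  have hsup : ((insert (range n) P).sup id) = range n := by
    apply le_antisymm
    · apply Finset.sup_le
      intro A hA
      rw [mem_insert] at hA
      rcases hA with rfl | hA
      · exact le_rfl
      · exact (mem_powerset.1 hA).trans (range_subset_range.2 hkn)
    · exact le_sup (f := id) (mem_insert_self _ _)
  have hsub : ∀ A ∈ insert (range n) P, A ⊆ range n := fun A hA => by
    rw [← hsup]; exact le_sup (f := id) hA
  refine ⟨insert (range n) P, ?_, by rw [hsup, card_range], ?_⟩
  · intro A hA B hB
    have hA' := hsub A hA
    have hB' := hsub B hB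
    rw [mem_insert] at hA hB ⊢
    rcases hA with rfl | hA
    · left; exact union_eq_left.2 hB'
    rcases hB with rfl | hB
    · left; exact union_eq_right.2 hA'
    right
    exact mem_powerset.2 (union_subset (mem_powerset.1 hA) (mem_powerset.1 hB))
  · have hcard : (2:ℝ) ^ k ≤ #(insert (range n) P) := by
      have : #P ≤ #(insert (range n) P) := card_le_card (subset_insert _ _)
      rw [card_powerset, card_range] at this
      exact_mod_cast this
    have hpos : (0:ℝ) < 2 ^ k := by positivity
    have hpos' := hpos.trans_le hcard
    have hsum : ∑ A ∈ insert (range n) P, (#A:ℝ) ≤ n + ∑ A ∈ P, (#A:ℝ) := by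
      by_cases hm : range n ∈ P
      · rw [insert_eq_of_mem hm]; linarith
      · rw [sum_insert hm, card_range]
    have hs2 : 2 * ∑ A ∈ P, (#A:ℝ) = k * 2 ^ k := by exact_mod_cast sum_pow_card k
    have hk1' : (n:ℝ) ≤ 2 ^ k := by exact_mod_cast hk1
    have hD : 2 * (n:ℝ) * density (insert (range n) P) =
        2 * (∑ A ∈ insert (range n) P, (#A : ℝ)) / #(insert (range n) P) := by
      rw [density, hsup, card_range]; exact frac_aux hn0.ne' hpos'.ne'
    rw [hD, div_le_iff₀ hpos']
    calc _ ≤ ((k:ℝ) + 2) * 2 ^ k := by linarith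
      _ ≤ (Real.logb 2 n + 3) * 2 ^ k := mul_le_mul_of_nonneg_right (by linarith) hpos.le
      _ ≤ _ := by
        have : 0 ≤ Real.logb 2 n := Real.logb_nonneg (by norm_num) (by exact_mod_cast (by omega))
        gcongr

/-- `s_n = (1 + o(1))·log₂ n/(2n)`, i.e. `2n·s_n / log₂ n → 1` as `n → ∞`. -/
theorem stmt_7 :
    Filter.Tendsto (fun n : ℕ => 2 * (n : ℝ) * minDensity n / Real.logb 2 (n : ℝ))
      Filter.atTop (nhds 1) := by
  have hLt : Filter.Tendsto (fun n : ℕ => Real.logb 2 (n:ℝ)) Filter.atTop Filter.atTop :=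
    (Real.tendsto_logb_atTop (by norm_num)).comp tendsto_natCast_atTop_atTop
  have hlow : Filter.Tendsto (fun x : ℝ => 1 - Real.logb 2 x / x) Filter.atTop (nhds 1) := by
    have h := (Real.isLittleO_log_id_atTop.tendsto_div_nhds_zero).div_const (Real.log 2)
    have h' := h.const_sub 1
    simp only [zero_div, sub_zero, id] at h'
    refine h'.congr (fun x => ?_)
    rw [Real.logb, div_right_comm]
  have hup : Filter.Tendsto (fun x : ℝ => 1 + 3 / x) Filter.atTop (nhds 1) := by
    have h := (Filter.tendsto_id (α := ℝ) (x := Filter.atTop)).const_div_atTop 3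
    simpa using h.const_add 1
  refine tendsto_of_tendsto_of_tendsto_of_le_of_le' (hlow.comp hLt) (hup.comp hLt) ?_ ?_
  · filter_upwards [hLt.eventually_ge_atTop 1, Filter.eventually_ge_atTop 2] with n hL hn
    have hn0 : (0:ℝ) < 2 * n := by exact_mod_cast (by omega : 0 < 2 * n)
    have hL0 : 0 < Real.logb 2 (n:ℝ) := by linarith
    simp only [Function.comp]
    rw [le_div_iff₀ hL0, sub_mul, div_mul_cancel₀ _ hL0.ne', one_mul, ← div_le_iff₀' hn0]
    obtain ⟨F, hF, hFn, -⟩ := upper hn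
    unfold minDensity
    refine le_csInf ⟨density F, F, hF, hFn, rfl⟩ ?_
    rintro d ⟨G, hG, hGn, rfl⟩
    rw [div_le_iff₀' hn0]
    exact lower hG hGn hn hL
  · filter_upwards [hLt.eventually_ge_atTop 1, Filter.eventually_ge_atTop 2] with n hL hn
    have hn0 : (0:ℝ) < 2 * n := by exact_mod_cast (by omega : 0 < 2 * n)
    have hL0 : 0 < Real.logb 2 (n:ℝ) := by linarith
    simp only [Function.comp]
    rw [div_le_iff₀ hL0, add_mul, div_mul_cancel₀ _ hL0.ne', one_mul]
    obtain ⟨F, hF, hFn, hd⟩ := upper hn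
    refine le_trans ?_ hd
    apply mul_le_mul_of_nonneg_left _ hn0.le
    apply csInf_le
    · exact ⟨0, by rintro d ⟨G, _, _, rfl⟩; exact density_nonneg G⟩
    · exact ⟨F, hF, hFn, rfl⟩
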